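/- arXiv:1710.09244 — 2 statements merged into one kernel-verified Lean document; each statement's English description precedes it below -/
import Mathlib

section
/- Let X, Y be real Hilbert spaces, T : X → Y a bounded linear operator, f† ∈ X, n ≥ 1 and m ≥ n integers, and Φ a concave index function such that VSC^{2n}(f†, Φ) holds. Then there exists a constant C > 0, depending only on n and m, such that for all α > 0 and δ > 0, every g ∈ Y with ‖g − T f†‖ ≤ δ, every Bregman-iterated Tikhonov sequence (f_k) for the data (g, α), and every ψ ∈ ℝ satisfying −t/α + Φ(t) ≤ ψ for all t ≥ 0, one has ‖f_m − f†‖² ≤ C (δ²/α + α^{2n−1} ψ). -/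
open scoped RealInnerProductSpace

open ContinuousLinearMap in
/-- The minimizer `u` of a Tikhonov functional satisfies the normal equation. -/
theorem tikhonov_normal_eq {X Y : Type*} [NormedAddCommGroup X] [InnerProductSpace ℝ X]
    [CompleteSpace X] [NormedAddCommGroup Y] [InnerProductSpace ℝ Y] [CompleteSpace Y]
    (T : X →L[ℝ] Y) (g : Y) (α : ℝ) (hα : 0 < α) (u v : X)
    (h : ∀ w : X, ‖T u - g‖ ^ 2 + α * ‖u - v‖ ^ 2 ≤ ‖T w - g‖ ^ 2 + α * ‖w - v‖ ^ 2) :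
    adjoint T (T u - g) + α • (u - v) = 0 := by
  set d := adjoint T (T u - g) + α • (u - v) with hd
  set K := ‖T d‖ ^ 2 + α * ‖d‖ ^ 2 with hK
  have hK0 : 0 ≤ K := by positivity
  have hN : ⟪T u - g, T d⟫ + α * ⟪u - v, d⟫ = ‖d‖ ^ 2 := by
    rw [← real_inner_self_eq_norm_sq d]
    nth_rewrite 3 [hd]
    rw [inner_add_left, adjoint_inner_left, real_inner_smul_left]
  have key : ∀ s : ℝ, 2 * s * ‖d‖ ^ 2 ≤ s ^ 2 * K := by
    intro s
    have h1 := h (u - s • d)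
    have e1 : T (u - s • d) - g = (T u - g) - s • T d := by
      rw [map_sub, map_smul]; abel
    have e2 : u - s • d - v = (u - v) - s • d := by abel
    rw [e1, e2, norm_sub_sq_real (T u - g), norm_sub_sq_real (u - v), real_inner_smul_right,
      real_inner_smul_right, norm_smul, norm_smul, mul_pow, mul_pow, Real.norm_eq_abs,
      sq_abs] at h1
    rw [hK]
    linarith [congrArg (2 * s * ·) hN]
  have h2 := key (‖d‖ ^ 2 / (K + 1))
  have h3 : ‖d‖ ^ 2 / (K + 1) * (K + 1) = ‖d‖ ^ 2 := by field_simp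
  set s := ‖d‖ ^ 2 / (K + 1)
  have hs : s ^ 2 * (K + 2) ≤ 0 := by rw [← h3] at h2; linarith
  have hs0 : s = 0 := by
    by_contra hne
    have : 0 < s ^ 2 := by positivity
    have : 0 < s ^ 2 * (K + 2) := by positivity
    linarith
  rw [hs0, zero_mul] at h3
  exact norm_eq_zero.mp (pow_eq_zero_iff two_ne_zero |>.mp h3.symm)

open ContinuousLinearMap in
/-- The regularized normal operator `T*T + α` is invertible for `α > 0`. -/
theorem isUnit_adjoint_comp_self_add_smul {X Y : Type*} [NormedAddCommGroup X]
    [InnerProductSpace ℝ X] [CompleteSpace X] [NormedAddCommGroup Y] [InnerProductSpace ℝ Y]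
    [CompleteSpace Y] (T : X →L[ℝ] Y) (α : ℝ) (hα : 0 < α) :
    IsUnit (adjoint T ∘L T + α • (1 : X →L[ℝ] X)) := by
  refine isUnit_of_forall_le_norm_inner_map _ (c := ⟨α, hα.le⟩) hα fun x => ?_
  have : ⟪(adjoint T ∘L T + α • (1 : X →L[ℝ] X)) x, x⟫ = ‖T x‖ ^ 2 + α * ‖x‖ ^ 2 := by
    simp [inner_add_left, adjoint_inner_left, real_inner_smul_left]
  rw [this, Real.norm_eq_abs]
  refine le_trans ?_ (le_abs_self _)
  change ‖x‖ ^ 2 * α ≤ _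
  nlinarith [sq_nonneg ‖T x‖]

open ContinuousLinearMap in
/-- If `T*T r + α r = α w`, then both `r` and `w - r` are bounded by `w`. -/
theorem norm_le_of_regularized_eq {X Y : Type*} [NormedAddCommGroup X]
    [InnerProductSpace ℝ X] [CompleteSpace X] [NormedAddCommGroup Y] [InnerProductSpace ℝ Y]
    [CompleteSpace Y] (T : X →L[ℝ] Y) (α : ℝ) (hα : 0 < α) (r w : X)
    (h : adjoint T (T r) + α • r = α • w) : ‖r‖ ≤ ‖w‖ ∧ ‖w - r‖ ≤ ‖w‖ := by
  have h1 : α * ⟪w - r, r⟫ = ‖T r‖ ^ 2 := by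
    rw [← real_inner_smul_left, smul_sub, ← h, add_sub_cancel_right, adjoint_inner_left,
      real_inner_self_eq_norm_sq]
  have h2 : 0 ≤ ⟪w - r, r⟫ := by
    refine (mul_nonneg_iff_of_pos_left hα).mp ?_
    rw [h1]; positivity
  have h3 : ‖w‖ ^ 2 = ‖w - r‖ ^ 2 + 2 * ⟪w - r, r⟫ + ‖r‖ ^ 2 := by
    rw [← norm_add_sq_real, sub_add_cancel]
  constructor <;> refine (sq_le_sq₀ (norm_nonneg _) (norm_nonneg _)).mp ?_ <;>
    nlinarith [sq_nonneg ‖r‖, sq_nonneg ‖w - r‖]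

/-- If `R` and `1 - R` are contractions with `R S = α (1 - R)` and `R` commutes with `S`, then
`‖R ^ m S ^ j v‖ ≤ α ^ j ‖R v‖` for `j < m`. -/
theorem norm_pow_apply_pow_le {X : Type*} [NormedAddCommGroup X] [NormedSpace ℝ X]
    (R S : X →L[ℝ] X) (α : ℝ) (hα : 0 < α) (hR : ∀ w, ‖R w‖ ≤ ‖w‖) (hR' : ∀ w, ‖w - R w‖ ≤ ‖w‖)
    (hRS : ∀ w, R (S w) = α • (w - R w)) (hSR : ∀ w, S (R w) = R (S w)) (j : ℕ) :
    ∀ (m : ℕ) (v : X), j < m → ‖(R ^ m) ((S ^ j) v)‖ ≤ α ^ j * ‖R v‖ := by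
  induction j with
  | zero =>
    intro m v hm
    induction m, hm using Nat.le_induction with
    | base => simp
    | succ k _ ih =>
      rw [pow_succ', mul_apply_eq_comp]
      exact (hR _).trans ih
  | succ j ih =>
    intro m v hm
    obtain ⟨m, rfl⟩ : ∃ k, m = k + 1 := ⟨m - 1, by omega⟩
    have hcomm : Commute R (S ^ j) :=
      Commute.pow_right (ContinuousLinearMap.ext fun w => (hSR w).symm) j
    have e : (R ^ (m + 1)) ((S ^ (j + 1)) v) = (R ^ m) ((S ^ j) (R (S v))) := by
      rw [pow_succ, pow_succ, mul_apply_eq_comp, mul_apply_eq_comp]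
      exact congrArg (R ^ m) (DFunLike.congr_fun hcomm.eq (S v))
    rw [e]
    refine (ih m _ (by omega)).trans ?_
    rw [← hSR v, hRS, norm_smul, Real.norm_of_nonneg hα.le, pow_succ, mul_assoc]
    gcongr
    exact hR' _

open ContinuousLinearMap in
/-- Bound of the regularized source element under a variational source condition. -/
theorem norm_sq_smul_le_of_vsc {X Y : Type*} [NormedAddCommGroup X]
    [InnerProductSpace ℝ X] [CompleteSpace X] [NormedAddCommGroup Y] [InnerProductSpace ℝ Y]
    [CompleteSpace Y] (T : X →L[ℝ] Y) (Φ : ℝ → ℝ) (pbar : Y)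
    (hvsc : ∀ p : Y, ⟪p, pbar⟫ ≤ 1 / 2 * ‖p‖ ^ 2 + Φ (‖adjoint T p‖ ^ 2))
    (α : ℝ) (hα : 0 < α) (ψ : ℝ) (hψ : ∀ t : ℝ, 0 ≤ t → -t / α + Φ t ≤ ψ) (x : X)
    (hx : adjoint T (T x) + α • x = adjoint T pbar) : ‖α • x‖ ^ 2 ≤ 4 * (α * ψ) := by
  set q := pbar - T x with hq
  have hTq : adjoint T q = α • x := by rw [hq, map_sub, ← hx, add_sub_cancel_left]
  have h1 : ⟪q, pbar⟫ = ‖q‖ ^ 2 + ‖α • x‖ ^ 2 / α := by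
    have e : pbar = q + T x := by rw [hq]; abel
    have e2 : ⟪q, T x⟫ = ‖α • x‖ ^ 2 / α := by
      rw [← adjoint_inner_left, hTq, ← real_inner_self_eq_norm_sq, real_inner_smul_right (α • x)]
      field_simp
    rw [← e2, ← real_inner_self_eq_norm_sq, ← inner_add_right, ← e]
  have h2 := hvsc ((1 / 2 : ℝ) • q)
  have h3 := hψ (‖adjoint T ((1 / 2 : ℝ) • q)‖ ^ 2) (by positivity)
  rw [map_smul, hTq, norm_smul (1 / 2 : ℝ) (α • x), mul_pow] at h2 h3
  rw [real_inner_smul_left, h1, norm_smul (1 / 2 : ℝ) q, mul_pow] at h2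
  norm_num at h2 h3
  set a := ‖α • x‖ ^ 2 / α with ha
  have e3 : -(1 / 4 * ‖α • x‖ ^ 2) / α = -(1 / 4) * a := by rw [ha]; ring
  have e4 : ‖α • x‖ ^ 2 = α * a := by rw [ha]; field_simp
  rw [e3] at h3
  have h4 : a ≤ 4 * ψ := by linarith [sq_nonneg ‖q‖]
  rw [e4]
  linarith [mul_le_mul_of_nonneg_left h4 hα.le]

/-- Convergence rates for Bregman iterated Tikhonov regularization in
Hilbert spaces under the even-order variational source condition `VSC^{2n}(f†, Φ)`:
there is `C > 0` depending only on `n` and `m ≥ n` such that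
`‖f_m − f†‖² ≤ C (δ²/α + α^{2n−1} ψ)` whenever `ψ` dominates `sup_{t≥0} (−t/α + Φ(t))`. -/
theorem stmt_3 (n m : ℕ) (hn : 1 ≤ n) (hnm : n ≤ m) :
    ∃ C : ℝ, 0 < C ∧
      ∀ (X Y : Type*) [NormedAddCommGroup X] [InnerProductSpace ℝ X] [CompleteSpace X]
        [NormedAddCommGroup Y] [InnerProductSpace ℝ Y] [CompleteSpace Y],
        ∀ (T : X →L[ℝ] Y) (fdag : X) (Φ : ℝ → ℝ),
        -- Φ is a concave index function
        ContinuousOn Φ (Set.Ici 0) → MonotoneOn Φ (Set.Ici 0) → Φ 0 = 0 →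
        (∀ t : ℝ, 0 ≤ t → 0 ≤ Φ t) → ConcaveOn ℝ (Set.Ici 0) Φ →
        -- VSC^{2n}(f†, Φ)
        (∃ pbar : Y,
          fdag = ((ContinuousLinearMap.adjoint T ∘L T) ^ (n - 1))
            (ContinuousLinearMap.adjoint T pbar) ∧
          ∀ p : Y, ⟪p, pbar⟫ ≤ 1 / 2 * ‖p‖ ^ 2
            + Φ (‖ContinuousLinearMap.adjoint T p‖ ^ 2)) →
        ∀ α δ : ℝ, 0 < α → 0 < δ →
          ∀ g : Y, ‖g - T fdag‖ ≤ δ →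
            -- Bregman iterated Tikhonov sequence for the data (g, α)
            ∀ f : ℕ → X, f 0 = 0 →
              (∀ k : ℕ, 1 ≤ k → ∀ h : X,
                ‖T (f k) - g‖ ^ 2 + α * ‖f k - f (k - 1)‖ ^ 2
                  ≤ ‖T h - g‖ ^ 2 + α * ‖h - f (k - 1)‖ ^ 2) →
              ∀ ψ : ℝ, (∀ t : ℝ, 0 ≤ t → -t / α + Φ t ≤ ψ) →
                ‖f m - fdag‖ ^ 2 ≤ C * (δ ^ 2 / α + α ^ (2 * n - 1) * ψ) := by
  refine ⟨2 * (m : ℝ) ^ 2 + 8, by positivity, ?_⟩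
  intro X Y _ _ _ _ _ _ T fdag Φ _ _ hΦ0 _ _ hvsc α δ hα _ g hg f hf0 hf ψ hψ
  obtain ⟨pbar, hfdag, hvsc⟩ := hvsc
  set S := ContinuousLinearMap.adjoint T ∘L T
  obtain ⟨u, hu⟩ := isUnit_adjoint_comp_self_add_smul T α hα
  set B : X →L[ℝ] X := ↑u⁻¹
  have hAB : ∀ w, S (B w) + α • B w = w := fun w => by
    have := DFunLike.congr_fun u.mul_inv w
    rw [hu] at this
    exact this
  have hBA : ∀ w, B (S w + α • w) = w := fun w => by
    have := DFunLike.congr_fun u.inv_mul w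
    rw [hu] at this
    exact this
  set R := α • B
  have hRapp : ∀ w, R w = α • B w := fun w => rfl
  have hAR : ∀ w, ContinuousLinearMap.adjoint T (T (R w)) + α • R w = α • w := fun w => by
    change S (R w) + _ = _
    rw [hRapp, map_smul, ← smul_add, hAB]
  have hSR : ∀ w, S (R w) = α • (w - R w) := fun w => by
    rw [smul_sub, ← hAR w]; exact (add_sub_cancel_right _ _).symm
  have hRS : ∀ w, R (S w) = α • (w - R w) := fun w => by
    have h := congrArg (α • ·) (hBA w)
    simp only [map_add, map_smul, smul_add] at h
    rw [hRapp, hRapp, smul_sub, ← h, add_sub_cancel_right]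
  have hR : ∀ w, ‖R w‖ ≤ ‖w‖ := fun w => (norm_le_of_regularized_eq T α hα _ w (hAR w)).1
  have hR' : ∀ w, ‖w - R w‖ ≤ ‖w‖ := fun w => (norm_le_of_regularized_eq T α hα _ w (hAR w)).2
  have hbias : ‖(R ^ m) fdag‖ ^ 2 ≤ 4 * (α ^ (2 * n - 1) * ψ) := by
    have h1 := norm_pow_apply_pow_le R S α hα hR hR' hRS
      (fun w => (hSR w).trans (hRS w).symm) (n - 1) m
      (ContinuousLinearMap.adjoint T pbar) (by omega)
    rw [← hfdag] at h1
    have h2 := norm_sq_smul_le_of_vsc T Φ pbar hvsc α hα ψ hψ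
      (B (ContinuousLinearMap.adjoint T pbar)) (hAB _)
    rw [← hRapp] at h2
    calc _ ≤ (α ^ (n - 1) * ‖R (ContinuousLinearMap.adjoint T pbar)‖) ^ 2 := by gcongr
      _ = α ^ (2 * (n - 1)) * ‖R (ContinuousLinearMap.adjoint T pbar)‖ ^ 2 := by ring
      _ ≤ α ^ (2 * (n - 1)) * (4 * (α * ψ)) := by gcongr
      _ = _ := by
        rw [show 2 * n - 1 = 2 * (n - 1) + 1 by omega, pow_succ]; ring
  set y := B (ContinuousLinearMap.adjoint T (g - T fdag)) with hy
  have hynorm : ‖y‖ ^ 2 ≤ δ ^ 2 / α := by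
    have h1 : ‖T y‖ ^ 2 + α * ‖y‖ ^ 2 = ⟪g - T fdag, T y⟫ := by
      rw [← ContinuousLinearMap.adjoint_inner_left,
        ← hAB (ContinuousLinearMap.adjoint T (g - T fdag)), ← hy, inner_add_left,
        real_inner_smul_left, real_inner_self_eq_norm_sq]
      congr 1
      change _ = ⟪ContinuousLinearMap.adjoint T (T y), y⟫
      rw [ContinuousLinearMap.adjoint_inner_left, real_inner_self_eq_norm_sq]
    have h2 := real_inner_le_norm (g - T fdag) (T y)
    have h3 : ‖g - T fdag‖ * ‖T y‖ ≤ δ * ‖T y‖ := by gcongr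
    rw [le_div_iff₀ hα]
    nlinarith [sq_nonneg (δ - 2 * ‖T y‖), sq_nonneg δ]
  have hstep : ∀ k, f (k + 1) - fdag = y + R (f k - fdag) := fun k => by
    have h1 := tikhonov_normal_eq T g α hα (f (k + 1)) (f k) (hf (k + 1) (by omega))
    rw [← hBA (f (k + 1) - fdag), hy, hRapp, ← map_smul, ← map_add]
    congr 1
    change ContinuousLinearMap.adjoint T (T (f (k + 1) - fdag)) + _ = _
    rw [← sub_eq_zero, ← h1]
    simp only [map_sub, smul_sub]
    abel
  have hnoise : ∀ k : ℕ, ‖f k - fdag + (R ^ k) fdag‖ ≤ k * ‖y‖ := by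
    intro k
    induction k with
    | zero => simp [hf0]
    | succ k ih =>
      have e : f (k + 1) - fdag + (R ^ (k + 1)) fdag = y + R (f k - fdag + (R ^ k) fdag) := by
        rw [hstep, pow_succ', mul_apply_eq_comp, map_add R, add_assoc]
      rw [e]
      refine (norm_add_le _ _).trans ?_
      have := hR (f k - fdag + (R ^ k) fdag)
      rw [Nat.cast_succ]
      linarith
  have hψ0 : 0 ≤ ψ := by simpa [hΦ0] using hψ 0 le_rfl
  have hsplit : ‖f m - fdag‖ ≤ m * ‖y‖ + ‖(R ^ m) fdag‖ := by
    have := norm_sub_le (f m - fdag + (R ^ m) fdag) ((R ^ m) fdag)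
    rw [add_sub_cancel_right] at this
    linarith [hnoise m]
  have hP : 0 ≤ α ^ (2 * n - 1) * ψ := by positivity
  have hD : 0 ≤ δ ^ 2 / α := by positivity
  have hmy : (m : ℝ) ^ 2 * ‖y‖ ^ 2 ≤ (m : ℝ) ^ 2 * (δ ^ 2 / α) := by gcongr
  have hmP : 0 ≤ (m : ℝ) ^ 2 * (α ^ (2 * n - 1) * ψ) := by positivity
  calc ‖f m - fdag‖ ^ 2 ≤ (m * ‖y‖ + ‖(R ^ m) fdag‖) ^ 2 := by gcongr
    _ ≤ 2 * (m ^ 2 * ‖y‖ ^ 2) + 2 * ‖(R ^ m) fdag‖ ^ 2 := by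
      linarith [sq_nonneg (m * ‖y‖ - ‖(R ^ m) fdag‖),
        show (m * ‖y‖ + ‖(R ^ m) fdag‖) ^ 2 + (m * ‖y‖ - ‖(R ^ m) fdag‖) ^ 2 =
          2 * (m ^ 2 * ‖y‖ ^ 2) + 2 * ‖(R ^ m) fdag‖ ^ 2 by ring]
    _ ≤ _ := by linarith
end

section
/- Let X, Y be real normed spaces, T : X → Y bounded linear, 1 < q ≤ 2 ≤ r, q* the conjugate of q, S(y) := (1/q)‖y‖^q, S*(p) := (1/q*)‖p‖^{q*}. Assume the Xu–Roach inequalities: there is c_S > 0 with S(y₁) − S(y₂) − η(y₁ − y₂) ≥ c_S · max(‖y₂‖, ‖y₁ − y₂‖)^{q−r} ‖y₁ − y₂‖^r for all y₁, y₂ ∈ Y and η ∈ ∂S(y₂), and there is c* > 0 with S*(p₁) − S*(p₂) − (p₁ − p₂)(G) ≥ c* ‖p₁ − p₂‖^{q*} for all p₁, p₂ ∈ Y* and G ∈ Y with G ∈ ∂S*(p₂). Let c > 0. Then there exist constants C, C̃ > 0, depending only on q, r, c, c_S, c*, such that the following holds. Let R : X → ℝ be convex; f† ∈ X; p̄ ∈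 Y* with p̄ ∘ T ∈ ∂R(f†); ω̄ ∈ X with T ω̄ ∈ ∂S*(p̄); Φ an index function; β ≥ 0, μ > 1, t̄ > 0; and ξ_t ∈ X* for t ∈ (0, t̄] with ξ_t ∈ ∂R(f† − t ω̄) satisfying: for all f ∈ X, t ∈ (0, t̄]: (ξ_t − p̄ ∘ T)(f† − t ω̄ − f) ≤ D_R^{ξ_t}(f, f† − t ω̄) + t² Φ(t^{−q} ‖T f − T f† + t T ω̄‖^q) + β t^{2μ}. Let δ > 0 and α > 0 satisfy δ ≤ c α^{q*−1} and α^{q*−1} ≤ t̄; let g ∈ Y with ‖g − T f†‖ ≤ δ; let f₁ ∈ X minimize h ↦ (1/α)S(Th − g) + R(h); let p̂ ∈ Y* satisfy p̂ ∘ T ∈ ∂R(f₁) and −α p̂ ∈ ∂S(T f₁ − g); let f₂ ∈ X minimize h ↦ (1/α)S(Th − g) + D_R^{p̂∘T}(h, f₁); and let p₂ ∈ Y* satisfy −α p₂ ∈ ∂S(T f₂ − g). Then for every M ∈ ℝ satisfying −C̃ (c + ‖T ω̄‖)^{q−r} α^{−(q*−1)} τ + Φ(τ^{q/r}) ≤ M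 for all τ ≥ 0, one has D_R^{p̄∘T}(f₂, f†) ≤ C ( δ^q/α + α^{2(q*−1)} M + β α^{2μ(q*−1)} ). -/
/-- Equality in the Fenchel–Young inequality for `(1/q)‖·‖^q`, i.e. `η` is a subgradient of
`(1/q)‖·‖^q` at `y`; the reverse inequality always holds. -/
def FenchelPair {Y : Type*} [NormedAddCommGroup Y] [NormedSpace ℝ Y] (q qs : ℝ) (y : Y)
    (η : Y →L[ℝ] ℝ) : Prop :=
  1 / q * ‖y‖ ^ q + 1 / qs * ‖η‖ ^ qs ≤ η y

section Duality

variable {Y : Type*} [NormedAddCommGroup Y] [NormedSpace ℝ Y] {q qs : ℝ}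

lemma Real.HolderConjugate.sub_one_mul_sub_one (h : q.HolderConjugate qs) :
    (q - 1) * (qs - 1) = 1 := by
  linarith [h.mul_eq_add]

lemma Real.HolderConjugate.rpow_sub_one_rpow (h : q.HolderConjugate qs) {x : ℝ} (hx : 0 ≤ x) :
    (x ^ (q - 1)) ^ qs = x ^ q := by
  rw [← Real.rpow_mul hx, h.sub_one_mul_conj]

lemma fenchel_young (h : q.HolderConjugate qs) (y : Y) (η : Y →L[ℝ] ℝ) :
    η y ≤ 1 / q * ‖y‖ ^ q + 1 / qs * ‖η‖ ^ qs := by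
  have h1 : η y ≤ ‖η‖ * ‖y‖ := (le_abs_self _).trans (η.le_opNorm y)
  have h2 := Real.young_inequality_of_nonneg (norm_nonneg y) (norm_nonneg η) h
  calc η y ≤ ‖y‖ * ‖η‖ := by linarith
    _ ≤ _ := h2
    _ = _ := by ring

lemma rpow_norm_dual_le_of_forall (h : q.HolderConjugate qs) {η : Y →L[ℝ] ℝ} {K : ℝ}
    (hK : ∀ y : Y, η y - 1 / q * ‖y‖ ^ q ≤ K) : 1 / qs * ‖η‖ ^ qs ≤ K := by
  have hq0 := h.pos
  have hqs0 := h.symm.pos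
  have hK0 : 0 ≤ K := by simpa [Real.zero_rpow h.ne_zero] using hK 0
  have key : ∀ u : Y, η u ≤ (qs * K) ^ (1 / qs) * ‖u‖ := by
    intro u
    rcases le_or_gt (η u) 0 with hneg | hpos
    · exact hneg.trans (by positivity)
    have hu : 0 < ‖u‖ := norm_pos_iff.2 (by rintro rfl; simp at hpos)
    set z : ℝ := η u / ‖u‖ with hz
    have hz0 : 0 < z := by positivity
    have h1 := hK ((z ^ (qs - 1) / ‖u‖) • u)
    have h2 : ‖(z ^ (qs - 1) / ‖u‖) • u‖ = z ^ (qs - 1) := by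
      rw [norm_smul, Real.norm_of_nonneg (by positivity), div_mul_cancel₀ _ hu.ne']
    have h3 : η ((z ^ (qs - 1) / ‖u‖) • u) = z ^ qs := by
      rw [map_smul, smul_eq_mul, div_mul_eq_mul_div, mul_div_assoc, ← hz,
        ← Real.rpow_add_one hz0.ne']
      ring_nf
    rw [h2, h3, h.symm.rpow_sub_one_rpow hz0.le] at h1
    have h4 : z ^ qs ≤ qs * K := by
      have h5 : 1 / q = 1 - 1 / qs := by simpa using h.symm.one_sub_inv.symm
      rw [h5] at h1
      have h6 : 1 / qs * z ^ qs ≤ K := by linarith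
      rwa [one_div, inv_mul_le_iff₀ hqs0] at h6
    have h5 : z ≤ (qs * K) ^ (1 / qs) := by
      calc z = (z ^ qs) ^ (1 / qs) := by
            rw [← Real.rpow_mul hz0.le, mul_one_div_cancel hqs0.ne', Real.rpow_one]
        _ ≤ _ := Real.rpow_le_rpow (by positivity) h4 (by positivity)
    rwa [hz, div_le_iff₀ hu] at h5
  have hn : ‖η‖ ≤ (qs * K) ^ (1 / qs) := by
    refine η.opNorm_le_bound (by positivity) fun u => ?_
    refine abs_le.2 ⟨?_, key u⟩
    have := key (-u)
    rw [map_neg, norm_neg] at this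
    linarith
  have h1 : ‖η‖ ^ qs ≤ qs * K := by
    calc ‖η‖ ^ qs ≤ ((qs * K) ^ (1 / qs)) ^ qs :=
          Real.rpow_le_rpow (norm_nonneg _) hn hqs0.le
      _ = qs * K := by
          rw [← Real.rpow_mul (by positivity), one_div_mul_cancel hqs0.ne', Real.rpow_one]
  rwa [one_div, inv_mul_le_iff₀ hqs0]

lemma exists_fenchelPair (h : q.HolderConjugate qs) (y : Y) :
    ∃ η : Y →L[ℝ] ℝ, FenchelPair q qs y η := by
  obtain ⟨g, hg1, hgy⟩ := exists_dual_vector'' ℝ y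
  refine ⟨‖y‖ ^ (q - 1) • g, ?_⟩
  have hqs0 := h.symm.pos
  have h1 : ‖‖y‖ ^ (q - 1) • g‖ ≤ ‖y‖ ^ (q - 1) := by
    rw [norm_smul, Real.norm_of_nonneg (by positivity)]
    exact mul_le_of_le_one_right (by positivity) hg1
  have h2 : ‖‖y‖ ^ (q - 1) • g‖ ^ qs ≤ ‖y‖ ^ q :=
    (Real.rpow_le_rpow (norm_nonneg _) h1 hqs0.le).trans_eq
      (h.rpow_sub_one_rpow (norm_nonneg _))
  have h3 : (‖y‖ ^ (q - 1) • g) y = ‖y‖ ^ q := by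
    have hy : g y = ‖y‖ := hgy
    have : ‖y‖ ^ (q - 1) * ‖y‖ ^ (1 : ℝ) = ‖y‖ ^ (q - 1 + 1) :=
      (Real.rpow_add_of_nonneg (norm_nonneg _) h.sub_one_pos.le zero_le_one).symm
    rw [smul_apply, hy, smul_eq_mul]
    simpa using this
  have h4 : 1 / q = 1 - 1 / qs := by simpa using h.symm.one_sub_inv.symm
  unfold FenchelPair
  rw [h3, h4]
  have := mul_le_mul_of_nonneg_left h2 (one_div_pos.2 hqs0).le
  linarith

namespace FenchelPair

lemma of_subgradient (h : q.HolderConjugate qs) {y : Y} {η : Y →L[ℝ] ℝ}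
    (hη : ∀ z : Y, 1 / q * ‖y‖ ^ q + η (z - y) ≤ 1 / q * ‖z‖ ^ q) : FenchelPair q qs y η := by
  have := rpow_norm_dual_le_of_forall h (η := η) (K := η y - 1 / q * ‖y‖ ^ q) fun z => by
    have := hη z
    rw [map_sub] at this
    linarith
  unfold FenchelPair
  linarith

lemma of_subgradient_dual (h : q.HolderConjugate qs) {y : Y} {η : Y →L[ℝ] ℝ}
    (hy : ∀ p : Y →L[ℝ] ℝ, 1 / qs * ‖η‖ ^ qs + (p - η) y ≤ 1 / qs * ‖p‖ ^ qs) :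
    FenchelPair q qs y η := by
  obtain ⟨p, hp⟩ := exists_fenchelPair h y
  have := hy p
  rw [sub_apply] at this
  unfold FenchelPair at *
  linarith

lemma subgradient (h : q.HolderConjugate qs) {y : Y} {η : Y →L[ℝ] ℝ}
    (hη : FenchelPair q qs y η) (z : Y) :
    1 / q * ‖y‖ ^ q + η (z - y) ≤ 1 / q * ‖z‖ ^ q := by
  have := fenchel_young h z η
  rw [map_sub]
  unfold FenchelPair at hη
  linarith

lemma subgradient_dual (h : q.HolderConjugate qs) {y : Y} {η : Y →L[ℝ] ℝ}
    (hη : FenchelPair q qs y η) (p : Y →L[ℝ] ℝ) :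
    1 / qs * ‖η‖ ^ qs + (p - η) y ≤ 1 / qs * ‖p‖ ^ qs := by
  have := fenchel_young h y p
  rw [sub_apply]
  unfold FenchelPair at hη
  linarith

lemma neg_smul (h : q.HolderConjugate qs) {y : Y} {η : Y →L[ℝ] ℝ}
    (hη : FenchelPair q qs y η) {α : ℝ} (hα : 0 < α) :
    FenchelPair q qs (-(α ^ (qs - 1) • y)) ((-α) • η) := by
  unfold FenchelPair at *
  have h1 : (α ^ (qs - 1) * ‖y‖) ^ q = α ^ qs * ‖y‖ ^ q := by
    rw [Real.mul_rpow (by positivity) (norm_nonneg _), h.symm.rpow_sub_one_rpow hα.le]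
  have h2 : (α * ‖η‖) ^ qs = α ^ qs * ‖η‖ ^ qs := Real.mul_rpow hα.le (norm_nonneg _)
  have h3 : α * α ^ (qs - 1) = α ^ qs := by
    rw [mul_comm, ← Real.rpow_add_one hα.ne']
    ring_nf
  have h4 : ((-α) • η) (-(α ^ (qs - 1) • y)) = α ^ qs * η y := by
    rw [← h3]
    simp
    ring
  rw [h4, norm_neg, norm_smul, norm_smul, norm_neg, Real.norm_of_nonneg hα.le,
    Real.norm_of_nonneg (by positivity : 0 ≤ α ^ (qs - 1)), h1, h2]
  have := mul_le_mul_of_nonneg_left hη (by positivity : 0 ≤ α ^ qs)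
  linarith

end FenchelPair

lemma le_rpow_of_mul_rpow_le (h : q.HolderConjugate qs) {k N V : ℝ} (hk : 0 < k) (hN : 0 ≤ N)
    (hV : 0 ≤ V) (hle : k * N ^ qs ≤ N * V) : N ≤ (V / k) ^ (q - 1) := by
  rcases hN.eq_or_lt with rfl | hN
  · positivity
  have h1 : N ^ qs = N * N ^ (qs - 1) := by
    rw [mul_comm, ← Real.rpow_add_one hN.ne']
    ring_nf
  have h2 : N ^ (qs - 1) ≤ V / k := by
    rw [le_div_iff₀ hk]
    rw [h1] at hle
    exact le_of_mul_le_mul_left (by linarith) hN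
  calc N = (N ^ (qs - 1)) ^ (q - 1) := by
        rw [← Real.rpow_mul hN.le, h.symm.sub_one_mul_sub_one, Real.rpow_one]
    _ ≤ _ := Real.rpow_le_rpow (by positivity) h2 h.sub_one_pos.le

lemma FenchelPair.norm_le (h : q.HolderConjugate qs) {y : Y} {η : Y →L[ℝ] ℝ}
    (hη : FenchelPair q qs y η) : ‖η‖ ≤ (qs * ‖y‖) ^ (q - 1) := by
  have hq0 := h.pos
  have hqs0 := h.symm.pos
  have h1 : η y ≤ ‖η‖ * ‖y‖ := (le_abs_self _).trans (η.le_opNorm y)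
  have h2 : 0 ≤ 1 / q * ‖y‖ ^ q := by positivity
  have h3 := le_rpow_of_mul_rpow_le h (one_div_pos.2 hqs0) (norm_nonneg η) (norm_nonneg y)
    (by unfold FenchelPair at hη; linarith)
  convert h3 using 2
  field_simp

/-- A `qs`-convexity bound on the dual norm turns into a lower bound of the Bregman distance of
`(1/q)‖·‖^q` by the distance of the dual elements. -/
lemma norm_sub_rpow_le_bregman (h : q.HolderConjugate qs) {cstar : ℝ}
    (hstar : ∀ (p₁ p₂ : Y →L[ℝ] ℝ) (G : Y),
      (∀ p : Y →L[ℝ] ℝ, 1 / qs * ‖p₂‖ ^ qs + (p - p₂) G ≤ 1 / qs * ‖p‖ ^ qs) →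
      1 / qs * ‖p₁‖ ^ qs - 1 / qs * ‖p₂‖ ^ qs - (p₁ - p₂) G ≥ cstar * ‖p₁ - p₂‖ ^ qs)
    {y₁ y₂ : Y} {η₁ η₂ : Y →L[ℝ] ℝ} (h₁ : FenchelPair q qs y₁ η₁)
    (h₂ : FenchelPair q qs y₂ η₂) :
    cstar * ‖η₁ - η₂‖ ^ qs ≤ 1 / q * ‖y₁‖ ^ q - 1 / q * ‖y₂‖ ^ q - η₂ (y₁ - y₂) := by
  have h3 := hstar η₂ η₁ y₁ (h₁.subgradient_dual h)
  have h4 := fenchel_young h y₁ η₁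
  rw [norm_sub_rev, sub_apply] at h3
  rw [map_sub]
  unfold FenchelPair at h₂
  linarith

lemma bregman_le (h : q.HolderConjugate qs) {cstar : ℝ} (hcstar : 0 < cstar)
    (hstar : ∀ (p₁ p₂ : Y →L[ℝ] ℝ) (G : Y),
      (∀ p : Y →L[ℝ] ℝ, 1 / qs * ‖p₂‖ ^ qs + (p - p₂) G ≤ 1 / qs * ‖p‖ ^ qs) →
      1 / qs * ‖p₁‖ ^ qs - 1 / qs * ‖p₂‖ ^ qs - (p₁ - p₂) G ≥ cstar * ‖p₁ - p₂‖ ^ qs)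
    {y₁ y₂ : Y} {η₂ : Y →L[ℝ] ℝ} (h₂ : FenchelPair q qs y₂ η₂) :
    1 / q * ‖y₁‖ ^ q - 1 / q * ‖y₂‖ ^ q - η₂ (y₁ - y₂)
      ≤ (1 / cstar) ^ (q - 1) * ‖y₁ - y₂‖ ^ q := by
  obtain ⟨η₁, h₁⟩ := exists_fenchelPair h y₁
  have h3 := norm_sub_rpow_le_bregman h hstar h₁ h₂
  have h4 : 1 / q * ‖y₁‖ ^ q - 1 / q * ‖y₂‖ ^ q - η₂ (y₁ - y₂)
      ≤ ‖η₁ - η₂‖ * ‖y₁ - y₂‖ := by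
    have h5 := h₁.subgradient h y₂
    have h6 : (η₁ - η₂) (y₁ - y₂) ≤ ‖η₁ - η₂‖ * ‖y₁ - y₂‖ :=
      (le_abs_self _).trans ((η₁ - η₂).le_opNorm _)
    rw [sub_apply] at h6
    rw [← neg_sub, map_neg] at h5
    linarith
  have h5 := le_rpow_of_mul_rpow_le h hcstar (norm_nonneg _) (norm_nonneg _) (h3.trans h4)
  refine (h4.trans (mul_le_mul_of_nonneg_right h5 (norm_nonneg _))).trans_eq ?_
  rw [div_eq_mul_one_div, Real.mul_rpow (norm_nonneg _) (by positivity)]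
  have : ‖y₁ - y₂‖ ^ (q - 1) * ‖y₁ - y₂‖ ^ (1 : ℝ) = ‖y₁ - y₂‖ ^ (q - 1 + 1) :=
    (Real.rpow_add_of_nonneg (norm_nonneg _) h.sub_one_pos.le zero_le_one).symm
  rw [Real.rpow_one, sub_add_cancel] at this
  rw [← this]
  ring

end Duality

section RealEstimates

variable {q qs : ℝ}

lemma le_const_mul_of_rpow_le_add (h : q.HolderConjugate qs) {A B δ m : ℝ} (hA : 0 ≤ A)
    (hm : 0 < m) (hδ : 0 ≤ δ) (hδm : δ ≤ m) (hB : B ≤ (qs * m) ^ (q - 1))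
    (hle : 1 / q * A ^ q ≤ 1 / q * δ ^ q + B * (A + δ)) :
    A ≤ (1 + 2 * q * qs ^ (q - 1)) ^ (qs - 1) * m := by
  have hq0 := h.pos
  have hqs0 := h.symm.pos
  have hq1 := h.sub_one_pos
  have hqs1 := h.symm.sub_one_pos
  set L : ℝ := 1 + 2 * q * qs ^ (q - 1) with hL
  have hL1 : 1 ≤ L := by
    have : 0 ≤ 2 * q * qs ^ (q - 1) := by positivity
    linarith
  rcases le_or_gt A m with hAm | hAm
  · have h1 : 1 ≤ L ^ (qs - 1) := Real.one_le_rpow hL1 hqs1.le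
    nlinarith
  have hA0 : 0 < A := hm.trans hAm
  have split : ∀ x : ℝ, 0 < x → x ^ q = x ^ (q - 1) * x := fun x hx => by
    rw [← Real.rpow_add_one hx.ne']
    ring_nf
  have h1 : δ ^ q ≤ m ^ (q - 1) * A := by
    calc δ ^ q ≤ m ^ q := Real.rpow_le_rpow hδ hδm hq0.le
      _ = m ^ (q - 1) * m := split m hm
      _ ≤ m ^ (q - 1) * A := by gcongr
  have h2 : B * (A + δ) ≤ qs ^ (q - 1) * m ^ (q - 1) * (2 * A) := by
    rw [Real.mul_rpow hqs0.le hm.le] at hB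
    calc B * (A + δ) ≤ qs ^ (q - 1) * m ^ (q - 1) * (A + δ) := by gcongr
      _ ≤ _ := by gcongr; linarith
  have h3 : A ^ q ≤ δ ^ q + q * (B * (A + δ)) := by
    have := mul_le_mul_of_nonneg_left hle hq0.le
    have e : ∀ z : ℝ, q * (1 / q * z) = z := fun z => by field_simp
    rwa [mul_add, e, e] at this
  have h4 : A ^ (q - 1) * A ≤ L * m ^ (q - 1) * A := by
    rw [← split A hA0]
    have := mul_le_mul_of_nonneg_left h2 hq0.le
    rw [hL]
    linarith
  have h5 : A ^ (q - 1) ≤ L * m ^ (q - 1) := le_of_mul_le_mul_right h4 hA0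
  have e : ∀ x : ℝ, 0 ≤ x → (x ^ (q - 1)) ^ (qs - 1) = x := fun x hx => by
    rw [← Real.rpow_mul hx, h.sub_one_mul_sub_one, Real.rpow_one]
  calc A = (A ^ (q - 1)) ^ (qs - 1) := (e A hA).symm
    _ ≤ (L * m ^ (q - 1)) ^ (qs - 1) := Real.rpow_le_rpow (by positivity) h5 hqs1.le
    _ = L ^ (qs - 1) * m := by rw [Real.mul_rpow (by positivity) (by positivity), e m hm.le]

lemma add_rpow_le_two_rpow_mul {x y r : ℝ} (hx : 0 ≤ x) (hy : 0 ≤ y) (hr : 0 ≤ r) :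
    (x + y) ^ r ≤ 2 ^ r * (x ^ r + y ^ r) := by
  have h1 : (x + y) ^ r ≤ (2 * max x y) ^ r :=
    Real.rpow_le_rpow (by positivity) (by linarith [le_max_left x y, le_max_right x y]) hr
  rw [Real.mul_rpow zero_le_two (by positivity)] at h1
  refine h1.trans (mul_le_mul_of_nonneg_left ?_ (by positivity))
  have hx' := Real.rpow_nonneg hx r
  have hy' := Real.rpow_nonneg hy r
  rcases max_choice x y with e | e <;> rw [e] <;> linarith

lemma rpow_sub_mul_rpow_le {δ m r : ℝ} (hδ : 0 < δ) (hδm : δ ≤ m) (hqr : q ≤ r) :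
    m ^ (q - r) * δ ^ r ≤ δ ^ q := by
  calc m ^ (q - r) * δ ^ r ≤ δ ^ (q - r) * δ ^ r :=
        mul_le_mul_of_nonneg_right (Real.rpow_le_rpow_of_nonpos hδ hδm (by linarith))
          (by positivity)
    _ = δ ^ q := by rw [← Real.rpow_add hδ, sub_add_cancel]

lemma mul_rpow_sub_mul_rpow_le {K m v x r D cS : ℝ} (hK : 0 < K) (hm : 0 < m) (hcS : 0 ≤ cS)
    (hx : 0 ≤ x) (hxv : x ≤ v) (hv : v ≤ K * m) (hr : 0 < r) (hqr : q ≤ r)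
    (hD : cS * v ^ (q - r) * x ^ r ≤ D) :
    cS * K ^ (q - r) * (m ^ (q - r) * x ^ r) ≤ D := by
  rcases (hx.trans hxv).eq_or_lt with hv0 | hv0
  · have : x = 0 := le_antisymm (hv0 ▸ hxv) hx
    simpa [this, Real.zero_rpow hr.ne'] using hD
  refine le_trans ?_ hD
  rw [← mul_assoc, mul_assoc cS, ← Real.mul_rpow hK.le hm.le]
  have := Real.rpow_le_rpow_of_nonpos hv0 hv (by linarith : q - r ≤ 0)
  gcongr

/-- Absorption step: a bound `M` of `Φ` minus a linear term matched to the lower bound of `D`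
turns the source condition into an estimate of `D`. -/
lemma bregman_le_of_majorant (h : q.HolderConjugate qs) {r α w c c₁ Cq δ n x D M E : ℝ}
    {Φ : ℝ → ℝ} (hr : 0 < r) (hqr : q ≤ r) (hα : 0 < α) (hcw : 0 < c + w) (hc₁ : 0 < c₁)
    (hδ : 0 < δ) (hδm : δ ≤ α ^ (qs - 1) * (c + w)) (hn : 0 ≤ n) (hx : 0 ≤ x)
    (hnx : n ≤ x + δ)
    (hlow : c₁ * ((α ^ (qs - 1) * (c + w)) ^ (q - r) * x ^ r) ≤ D)
    (hup : D ≤ Cq * δ ^ q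
      + α * ((α ^ (qs - 1)) ^ 2 * Φ ((α ^ (qs - 1)) ^ (-q) * n ^ q) + E))
    (hM : ∀ τ : ℝ, 0 ≤ τ →
      -(c₁ / (2 * 2 ^ r)) * (c + w) ^ (q - r) * α ^ (-(qs - 1)) * τ + Φ (τ ^ (q / r)) ≤ M) :
    D ≤ 2 * ((Cq + c₁ / 2) * δ ^ q + α * ((α ^ (qs - 1)) ^ 2 * M + E)) := by
  have hαt : α * α ^ (qs - 1) = (α ^ (qs - 1)) ^ q := by
    rw [h.symm.rpow_sub_one_rpow hα.le, mul_comm, ← Real.rpow_add_one hα.ne']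
    ring_nf
  have hαi : α ^ (-(qs - 1)) = (α ^ (qs - 1))⁻¹ := Real.rpow_neg hα.le _
  rw [hαi] at hM
  have ht0 : 0 < α ^ (qs - 1) := by positivity
  set t : ℝ := α ^ (qs - 1) with ht
  have h1 := hM ((n / t) ^ r) (by positivity)
  have h2 : ((n / t) ^ r) ^ (q / r) = t ^ (-q) * n ^ q := by
    rw [← Real.rpow_mul (by positivity), mul_div_cancel₀ _ hr.ne', Real.div_rpow hn ht0.le,
      Real.rpow_neg ht0.le]
    ring
  rw [h2] at h1
  have h3 : α * t ^ 2 * (c₁ / (2 * 2 ^ r) * (c + w) ^ (q - r) * t⁻¹ * (n / t) ^ r)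
      = c₁ / (2 * 2 ^ r) * ((t * (c + w)) ^ (q - r) * n ^ r) := by
    have e1 : (t * (c + w)) ^ (q - r) = t ^ q / t ^ r * (c + w) ^ (q - r) := by
      rw [Real.mul_rpow ht0.le hcw.le, Real.rpow_sub ht0]
    rw [e1, ← hαt, Real.div_rpow hn ht0.le]
    have : 0 < t ^ r := by positivity
    field_simp
  have h4 : (t * (c + w)) ^ (q - r) * n ^ r
      ≤ 2 ^ r * ((t * (c + w)) ^ (q - r) * x ^ r + δ ^ q) := by
    have e1 : n ^ r ≤ 2 ^ r * (x ^ r + δ ^ r) :=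
      (Real.rpow_le_rpow hn hnx hr.le).trans (add_rpow_le_two_rpow_mul hx hδ.le hr.le)
    have e2 := rpow_sub_mul_rpow_le hδ hδm hqr
    have e3 : 0 ≤ (t * (c + w)) ^ (q - r) := by positivity
    calc _ ≤ (t * (c + w)) ^ (q - r) * (2 ^ r * (x ^ r + δ ^ r)) := by gcongr
      _ = 2 ^ r * ((t * (c + w)) ^ (q - r) * x ^ r + (t * (c + w)) ^ (q - r) * δ ^ r) := by ring
      _ ≤ _ := by gcongr
  have h5 : c₁ / (2 * 2 ^ r) * ((t * (c + w)) ^ (q - r) * n ^ r) ≤ D / 2 + c₁ / 2 * δ ^ q := by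
    have e1 : 0 < (2 : ℝ) ^ r := by positivity
    calc _ ≤ c₁ / (2 * 2 ^ r) * (2 ^ r * ((t * (c + w)) ^ (q - r) * x ^ r + δ ^ q)) := by gcongr
      _ = c₁ * ((t * (c + w)) ^ (q - r) * x ^ r) / 2 + c₁ / 2 * δ ^ q := by field_simp
      _ ≤ _ := by linarith
  have h6 := mul_le_mul_of_nonneg_left h1 (by positivity : 0 ≤ α * t ^ 2)
  linarith

/-- Young's inequality with weight `α`. -/
lemma mul_le_young_weighted (h : q.HolderConjugate qs) {α P z : ℝ} (hα : 0 < α) (hP : 0 ≤ P)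
    (hz : 0 ≤ z) : P * z ≤ (1 / q * z ^ q + 1 / qs * (α * P) ^ qs) / α := by
  have := Real.young_inequality_of_nonneg hz (by positivity : 0 ≤ α * P) h
  rw [le_div_iff₀ hα]
  calc P * z * α = z * (α * P) := by ring
    _ ≤ _ := this
    _ = _ := by ring

lemma le_mul_add_of_le_add {p p' k κ u v z Z : ℝ} (hp : 0 < p) (hp' : 0 < p') (hk : 0 < k)
    (hκ : 0 ≤ κ) (hu : 0 ≤ u) (hv : 0 ≤ v) (hZ : Z ≤ 2 / p * u + 2 / p' * z)
    (hz : z ≤ 2 / k * (κ * u + v)) :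
    Z ≤ (2 / p + 2 / p' * (2 / k) * (κ + 1)) * (u + v) := by
  have h1 : κ * u + v ≤ (κ + 1) * (u + v) := by
    have := mul_nonneg hκ hv
    linarith
  calc Z ≤ 2 / p * u + 2 / p' * z := hZ
    _ ≤ 2 / p * (u + v) + 2 / p' * (2 / k * ((κ + 1) * (u + v))) := by
      gcongr
      · linarith
      · exact hz.trans (by gcongr)
    _ = _ := by ring

end RealEstimates

/-- Main convergence rate theorem (Theorem `rate_theorem` of the paper)
for Bregman iterated variational regularization under the third order variational
source condition `VSC³(f†, Φ, R, S)`: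
`D_R^{p̄∘T}(f₂, f†) ≤ C ( δ^q/α + α^{2(q*−1)} M + β α^{2μ(q*−1)} )`. -/
theorem stmt_11 {X Y : Type*} [NormedAddCommGroup X] [NormedSpace ℝ X]
    [NormedAddCommGroup Y] [NormedSpace ℝ Y]
    (T : X →L[ℝ] Y) (q r qs : ℝ) (hq : 1 < q) (hq2 : q ≤ 2) (hr : 2 ≤ r)
    (hqs : 1 / q + 1 / qs = 1)
    -- Xu–Roach inequality for S = (1/q)‖·‖^q
    (cS : ℝ) (hcS : 0 < cS)
    (hXRS : ∀ (y₁ y₂ : Y) (η : Y →L[ℝ] ℝ),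
      (∀ h : Y, 1 / q * ‖y₂‖ ^ q + η (h - y₂) ≤ 1 / q * ‖h‖ ^ q) →
      1 / q * ‖y₁‖ ^ q - 1 / q * ‖y₂‖ ^ q - η (y₁ - y₂)
        ≥ cS * (max ‖y₂‖ ‖y₁ - y₂‖) ^ (q - r) * ‖y₁ - y₂‖ ^ r)
    -- Xu–Roach inequality for S* = (1/q*)‖·‖^{q*}
    (cstar : ℝ) (hcstar : 0 < cstar)
    (hXRSstar : ∀ (p₁ p₂ : Y →L[ℝ] ℝ) (G : Y),
      (∀ p : Y →L[ℝ] ℝ, 1 / qs * ‖p₂‖ ^ qs + (p - p₂) G ≤ 1 / qs * ‖p‖ ^ qs) →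
      1 / qs * ‖p₁‖ ^ qs - 1 / qs * ‖p₂‖ ^ qs - (p₁ - p₂) G ≥ cstar * ‖p₁ - p₂‖ ^ qs)
    (c : ℝ) (hc : 0 < c) :
    ∃ C Ctld : ℝ, 0 < C ∧ 0 < Ctld ∧
      ∀ R : X → ℝ, ConvexOn ℝ Set.univ R →
      ∀ (fdag : X) (pbar : Y →L[ℝ] ℝ),
        (∀ h : X, R fdag + (pbar.comp T) (h - fdag) ≤ R h) →
      ∀ ωbar : X,
        (∀ p : Y →L[ℝ] ℝ,
          1 / qs * ‖pbar‖ ^ qs + (p - pbar) (T ωbar) ≤ 1 / qs * ‖p‖ ^ qs) →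
      ∀ Φ : ℝ → ℝ, ContinuousOn Φ (Set.Ici 0) → MonotoneOn Φ (Set.Ici 0) →
        Φ 0 = 0 → (∀ t : ℝ, 0 ≤ t → 0 ≤ Φ t) →
      ∀ β μ tbar : ℝ, 0 ≤ β → 1 < μ → 0 < tbar →
      ∀ ξ : ℝ → (X →L[ℝ] ℝ),
        (∀ t ∈ Set.Ioc (0 : ℝ) tbar, ∀ h : X,
          R (fdag - t • ωbar) + (ξ t) (h - (fdag - t • ωbar)) ≤ R h) →
        -- third order variational source condition
        (∀ f : X, ∀ t ∈ Set.Ioc (0 : ℝ) tbar,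
          (ξ t - pbar.comp T) (fdag - t • ωbar - f)
            ≤ R f - R (fdag - t • ωbar) - (ξ t) (f - (fdag - t • ωbar))
              + t ^ 2 * Φ (t ^ (-q) * ‖T f - T fdag + t • T ωbar‖ ^ q)
              + β * t ^ (2 * μ)) →
      ∀ δ α : ℝ, 0 < δ → 0 < α → δ ≤ c * α ^ (qs - 1) → α ^ (qs - 1) ≤ tbar →
      ∀ g : Y, ‖g - T fdag‖ ≤ δ →
      ∀ fhat : X,
        (∀ h : X, 1 / α * (1 / q * ‖T fhat - g‖ ^ q) + R fhat
          ≤ 1 / α * (1 / q * ‖T h - g‖ ^ q) + R h) →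
      ∀ phat : Y →L[ℝ] ℝ,
        (∀ h : X, R fhat + (phat.comp T) (h - fhat) ≤ R h) →
        (∀ y : Y, 1 / q * ‖T fhat - g‖ ^ q + ((-α) • phat) (y - (T fhat - g))
          ≤ 1 / q * ‖y‖ ^ q) →
      -- f₂ minimizes the Bregman iterated Tikhonov functional
      ∀ f₂ : X,
        (∀ h : X,
          1 / α * (1 / q * ‖T f₂ - g‖ ^ q)
              + (R f₂ - R fhat - (phat.comp T) (f₂ - fhat))
            ≤ 1 / α * (1 / q * ‖T h - g‖ ^ q)
              + (R h - R fhat - (phat.comp T) (h - fhat))) →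
      ∀ p₂ : Y →L[ℝ] ℝ,
        (∀ y : Y, 1 / q * ‖T f₂ - g‖ ^ q + ((-α) • p₂) (y - (T f₂ - g))
          ≤ 1 / q * ‖y‖ ^ q) →
      ∀ M : ℝ,
        (∀ τ : ℝ, 0 ≤ τ →
          -Ctld * (c + ‖T ωbar‖) ^ (q - r) * α ^ (-(qs - 1)) * τ + Φ (τ ^ (q / r))
            ≤ M) →
        R f₂ - R fdag - (pbar.comp T) (f₂ - fdag)
          ≤ C * (δ ^ q / α + α ^ (2 * (qs - 1)) * M + β * α ^ (2 * μ * (qs - 1))) := by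
  have hconj : q.HolderConjugate qs :=
    Real.holderConjugate_iff.2 ⟨hq, by simpa [one_div] using hqs⟩
  have hq0 := hconj.pos
  have hqs0 := hconj.symm.pos
  have hqr : q ≤ r := hq2.trans hr
  have hr0 : 0 < r := by linarith
  set K : ℝ := (1 + 2 * q * qs ^ (q - 1)) ^ (qs - 1) + 1 with hK
  have hK1 : 1 ≤ K := le_add_of_nonneg_left (by positivity)
  have hK0 : 0 < K := by linarith
  set c₁ : ℝ := cS * K ^ (q - r) with hc₁
  have hc₁0 : 0 < c₁ := by positivity
  set Cq : ℝ := (1 / cstar) ^ (q - 1) with hCq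
  have hCq0 : 0 < Cq := by positivity
  refine ⟨2 / q + 2 / qs * (2 / cstar) * (Cq + c₁ / 2 + 1), c₁ / (2 * 2 ^ r),
    by positivity, by positivity, ?_⟩
  intro R _ fdag pbar hpbar ωbar hω Φ _ _ hΦ0 _ β μ tbar hβ _ _ ξ _ hvsc δ α hδ hα hδα
    hαt g hg f₁ hf₁ phat hphat hphatS f₂ hf₂ p₂ _ M hM
  have hpair_bar := (FenchelPair.of_subgradient_dual hconj hω).neg_smul hconj hα
  have hpair_hat := FenchelPair.of_subgradient hconj hphatS
  have ht0 : 0 < α ^ (qs - 1) := by positivity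
  have htt : (α ^ (qs - 1)) ^ 2 = α ^ (2 * (qs - 1)) := by
    rw [← Real.rpow_natCast, ← Real.rpow_mul hα.le]
    push_cast
    ring_nf
  have htμ : (α ^ (qs - 1)) ^ (2 * μ) = α ^ (2 * μ * (qs - 1)) := by
    rw [← Real.rpow_mul hα.le]
    ring_nf
  have hM0 : 0 ≤ M := by
    have := hM 0 le_rfl
    rwa [Real.zero_rpow (by positivity), hΦ0, mul_zero, zero_add] at this
  rw [← htt, ← htμ]
  set t : ℝ := α ^ (qs - 1) with ht
  set w : ℝ := ‖T ωbar‖ with hw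
  have hw0 : 0 ≤ w := norm_nonneg _
  have hcw : 0 < c + w := by linarith
  have hm0 : 0 < t * (c + w) := by positivity
  have hδm : δ ≤ t * (c + w) := by nlinarith
  have htw : t * w ≤ t * (c + w) := by nlinarith
  have hg' : ‖T fdag - g‖ ≤ δ := by rwa [norm_sub_rev]
  set a : Y := T f₁ - g with ha
  set b : Y := -(t • T ωbar) with hb
  have hbn : ‖b‖ = t * w := by rw [hb, norm_neg, norm_smul, Real.norm_of_nonneg ht0.le]
  set η : Y →L[ℝ] ℝ := (-α) • pbar with hη
  have hηapp : ∀ y, η y = -(α * pbar y) := fun y => by simp [hη]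
  -- A priori bound on the residual of the first iterate
  have hscale : ∀ u v U V : ℝ, 1 / α * u + U ≤ 1 / α * v + V → u + α * U ≤ v + α * V := by
    intro u v U V huv
    have := mul_le_mul_of_nonneg_left huv hα.le
    field_simp at this
    linarith
  have hresid : ‖a‖ ≤ (1 + 2 * q * qs ^ (q - 1)) ^ (qs - 1) * (t * (c + w)) := by
    refine le_const_mul_of_rpow_le_add hconj (norm_nonneg _) hm0 hδ.le hδm (B := ‖η‖) ?_ ?_
    · refine (hpair_bar.norm_le hconj).trans ?_
      rw [hbn]
      exact Real.rpow_le_rpow (by positivity) (by gcongr) hconj.sub_one_pos.le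
    have h1 := hscale _ _ _ _ (hf₁ fdag)
    have h2 := mul_le_mul_of_nonneg_left (hpbar f₁) hα.le
    have h3 : η (a - (T fdag - g)) ≤ ‖η‖ * (‖a‖ + δ) :=
      (le_abs_self _).trans <| (η.le_opNorm _).trans <|
        mul_le_mul_of_nonneg_left ((norm_sub_le _ _).trans (by gcongr)) (norm_nonneg _)
    have h4 : a - (T fdag - g) = T f₁ - T fdag := by rw [ha]; abel
    have h5 : ‖T fdag - g‖ ^ q ≤ δ ^ q := Real.rpow_le_rpow (norm_nonneg _) hg' hq0.le
    have h6 := mul_le_mul_of_nonneg_left h5 (one_div_pos.2 hq0).le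
    rw [h4, hηapp, map_sub] at h3
    simp only [ContinuousLinearMap.comp_apply, map_sub] at h2
    linarith
  -- The Bregman distance of the data functional between the first residual and `-t T ωbar`
  set D : ℝ := 1 / q * ‖a‖ ^ q - 1 / q * ‖b‖ ^ q - η (a - b) with hD
  have hlow : c₁ * ((t * (c + w)) ^ (q - r) * ‖a - b‖ ^ r) ≤ D := by
    refine mul_rpow_sub_mul_rpow_le hK0 hm0 hcS.le (norm_nonneg _) (le_max_right ‖b‖ _) ?_ hr0
      hqr (hXRS a b η (hpair_bar.subgradient hconj))
    refine max_le ?_ ((norm_sub_le _ _).trans ?_)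
    · rw [hbn]
      nlinarith
    · rw [hbn, hK]
      linarith
  have hn : ‖T f₁ - T fdag + t • T ωbar‖ ≤ ‖a - b‖ + δ := by
    have : T f₁ - T fdag + t • T ωbar = (a - b) - (T fdag - g) := by rw [ha, hb]; abel
    rw [this]
    exact (norm_sub_le _ _).trans (by gcongr)
  have hup : D ≤ Cq * δ ^ q
      + α * (t ^ 2 * Φ (t ^ (-q) * ‖T f₁ - T fdag + t • T ωbar‖ ^ q) + β * t ^ (2 * μ)) := by
    have h1 := hscale _ _ _ _ (hf₁ (fdag - t • ωbar))
    have h2 := mul_le_mul_of_nonneg_left (hvsc f₁ t ⟨ht0, hαt⟩) hα.le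
    have h3 := bregman_le hconj hcstar hXRSstar (y₁ := T (fdag - t • ωbar) - g) hpair_bar
    have h4 : T (fdag - t • ωbar) - g - b = T fdag - g := by
      rw [hb, map_sub, map_smul]
      abel
    have h5 : ‖T fdag - g‖ ^ q ≤ δ ^ q := Real.rpow_le_rpow (norm_nonneg _) hg' hq0.le
    have h6 := mul_le_mul_of_nonneg_left h5 hCq0.le
    rw [h4, hηapp, ← hCq] at h3
    have h7 : pbar (a - b) = pbar (T f₁) - pbar g + t * pbar (T ωbar) := by
      rw [ha, hb]
      simp
    rw [hD, hηapp, h7]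
    simp only [sub_apply, ContinuousLinearMap.comp_apply, map_sub, map_smul,
      smul_eq_mul] at h1 h2 h3
    linarith
  have hDle : D ≤ 2 * ((Cq + c₁ / 2) * δ ^ q + α * (t ^ 2 * M + β * t ^ (2 * μ))) :=
    bregman_le_of_majorant hconj hr0 hqr hα hcw hc₁0 hδ hδm (norm_nonneg _) (norm_nonneg _)
      hn hlow hup hM
  -- Transfer to the second iterate by duality
  have hdual : cstar * (α * ‖phat - pbar‖) ^ qs ≤ D := by
    have h1 := norm_sub_rpow_le_bregman hconj hXRSstar hpair_hat hpair_bar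
    have h2 : ‖(-α) • phat - η‖ = α * ‖phat - pbar‖ := by
      have h3 : (-α) • phat - η = (-α) • (phat - pbar) := by
        ext y
        simp [hη]
        ring
      rw [h3, norm_smul, norm_neg, Real.norm_of_nonneg hα.le]
    rwa [h2] at h1
  have hfinal : R f₂ - R fdag - (pbar.comp T) (f₂ - fdag)
      ≤ 2 / q * (δ ^ q / α) + 2 / qs * ((α * ‖phat - pbar‖) ^ qs / α) := by
    have h1 := hf₂ fdag
    have h2 : ‖T fdag - g‖ ^ q ≤ δ ^ q := Real.rpow_le_rpow (norm_nonneg _) hg' hq0.le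
    have h3 := mul_le_mul_of_nonneg_left h2 (by positivity : 0 ≤ 1 / α * (1 / q))
    have h4 : (phat - pbar) (T f₂ - g - (T fdag - g))
        ≤ ‖phat - pbar‖ * (‖T f₂ - g‖ + δ) :=
      (le_abs_self _).trans <| ((phat - pbar).le_opNorm _).trans <|
        mul_le_mul_of_nonneg_left ((norm_sub_le _ _).trans (by gcongr)) (norm_nonneg _)
    have h5 := mul_le_young_weighted hconj hα (norm_nonneg (phat - pbar))
      (norm_nonneg (T f₂ - g))
    have h6 := mul_le_young_weighted hconj hα (norm_nonneg (phat - pbar)) hδ.le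
    simp only [sub_apply, ContinuousLinearMap.comp_apply, map_sub] at h1 h4 ⊢
    ring_nf at h1 h3 h4 h5 h6 ⊢
    linarith
  have hE : 0 ≤ δ ^ q / α := by positivity
  have hE' : 0 ≤ t ^ 2 * M + β * t ^ (2 * μ) := by positivity
  have hquot : (α * ‖phat - pbar‖) ^ qs / α
      ≤ 2 / cstar * ((Cq + c₁ / 2) * (δ ^ q / α) + (t ^ 2 * M + β * t ^ (2 * μ))) := by
    have h1 := hdual.trans hDle
    rw [div_le_iff₀ hα]
    rw [mul_comm, ← le_div_iff₀ hcstar] at h1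
    refine h1.trans_eq ?_
    field_simp
  rw [add_assoc (δ ^ q / α)]
  exact le_mul_add_of_le_add hq0 hqs0 hcstar (by positivity) hE hE' hfinal hquot
end
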